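/- Let ρ be a two-qubit density matrix whose partial trace over the second factor equals (1/2)·I₂. Then ρ is separable if and only if every eigenvalue of ρ is at most 1/2 (equivalently, λ_max(ρ) ≤ 1/2). -/

import Mathlib

open Matrix
open scoped Kronecker ComplexOrder

/-- Partial trace over the second factor of a two-qubit matrix. -/
noncomputable def ptrace2 (ρ : Matrix (Fin 2 × Fin 2) (Fin 2 × Fin 2) ℂ) :
    Matrix (Fin 2) (Fin 2) ℂ :=
  fun i j => ∑ k, ρ (i, k) (j, k)

/-- A density matrix: positive semidefinite of trace 1. -/
def IsDensity {n : Type*} [Fintype n] (ρ : Matrix n n ℂ) : Prop :=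
  ρ.PosSemidef ∧ ρ.trace = 1

/-- Separability of a two-qubit density matrix: a finite convex combination of
Kronecker products of single-qubit density matrices. -/
def SeparableState (ρ : Matrix (Fin 2 × Fin 2) (Fin 2 × Fin 2) ℂ) : Prop :=
  ∃ (K : ℕ) (_ : 1 ≤ K) (w : Fin K → ℝ)
    (σ τ : Fin K → Matrix (Fin 2) (Fin 2) ℂ),
    (∀ k, 0 ≤ w k) ∧ (∑ k, w k = 1) ∧
    (∀ k, IsDensity (σ k)) ∧ (∀ k, IsDensity (τ k)) ∧
    ρ = ∑ k, (w k : ℂ) • (σ k ⊗ₖ τ k)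

section General

variable {n : Type*} [Fintype n] [DecidableEq n]

lemma Matrix.IsHermitian.eq_mul_diagonal_mul {A : Matrix n n ℂ} (hA : A.IsHermitian) :
    A = (hA.eigenvectorUnitary : Matrix n n ℂ) * diagonal (fun i => (hA.eigenvalues i : ℂ)) *
      (hA.eigenvectorUnitary : Matrix n n ℂ)ᴴ := by
  conv_lhs => rw [hA.spectral_theorem]
  rfl

lemma Matrix.IsHermitian.eigenvectorUnitary_mul_conjTranspose {A : Matrix n n ℂ}
    (hA : A.IsHermitian) :
    (hA.eigenvectorUnitary : Matrix n n ℂ) * (hA.eigenvectorUnitary : Matrix n n ℂ)ᴴ = 1 :=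
  Unitary.coe_mul_star_self _

lemma Matrix.PosSemidef.trace_smul_one_sub {A : Matrix n n ℂ} (hA : A.PosSemidef) :
    (A.trace • (1 : Matrix n n ℂ) - A).PosSemidef := by
  have h : A.trace • (1 : Matrix n n ℂ) - A = (hA.1.eigenvectorUnitary : Matrix n n ℂ) *
      diagonal (fun i => A.trace - (hA.1.eigenvalues i : ℂ)) *
      (hA.1.eigenvectorUnitary : Matrix n n ℂ)ᴴ := by
    have h1 : diagonal (fun i => A.trace - (hA.1.eigenvalues i : ℂ)) =
        A.trace • (1 : Matrix n n ℂ) - diagonal (fun i => (hA.1.eigenvalues i : ℂ)) := by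
      rw [smul_one_eq_diagonal, diagonal_sub]
    rw [h1, mul_sub, sub_mul, ← hA.1.eq_mul_diagonal_mul, mul_smul_comm, mul_one, smul_mul_assoc,
      hA.1.eigenvectorUnitary_mul_conjTranspose]
  rw [h]
  refine (PosSemidef.diagonal fun i => ?_).mul_mul_conjTranspose_same _
  have htr : A.trace = ((∑ j, hA.1.eigenvalues j : ℝ) : ℂ) := by
    rw [hA.1.trace_eq_sum_eigenvalues]; simp
  rw [Pi.zero_apply, sub_nonneg, htr]
  exact Complex.real_le_real.2
    (Finset.single_le_sum (fun j _ => hA.eigenvalues_nonneg j) (Finset.mem_univ i))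

lemma Matrix.PosSemidef.exists_one_sub_smul {A : Matrix n n ℂ} (hA : A.PosSemidef) :
    ∃ ε : ℝ, 0 < ε ∧ (1 - (ε : ℂ) • A).PosSemidef := by
  have ht := hA.trace_nonneg
  obtain ⟨t, ht0, htr⟩ : ∃ t : ℝ, 0 ≤ t ∧ A.trace = t :=
    ⟨A.trace.re, (Complex.le_def.1 ht).1,
      Complex.ext (by simp) (by simpa using (Complex.le_def.1 ht).2.symm)⟩
  have hpos : 0 < 1 + t := by linarith
  refine ⟨(1 + t)⁻¹, by positivity, ?_⟩
  have h : 1 - (((1 + t)⁻¹ : ℝ) : ℂ) • A =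
      (((1 + t)⁻¹ : ℝ) : ℂ) • ((A.trace • (1 : Matrix n n ℂ) - A) + 1) := by
    have h2 : (1 : Matrix n n ℂ) =
        (((1 + t)⁻¹ : ℝ) : ℂ) • (((1 + t : ℝ) : ℂ) • (1 : Matrix n n ℂ)) := by
      rw [smul_smul, ← Complex.ofReal_mul, inv_mul_cancel₀ hpos.ne']; simp
    nth_rw 1 [h2]
    rw [← smul_sub, htr]
    congr 1
    push_cast
    rw [add_smul, one_smul]
    abel
  rw [h]
  exact (hA.trace_smul_one_sub.add PosSemidef.one).smul
    (by exact_mod_cast (inv_nonneg.2 hpos.le : (0 : ℝ) ≤ (1 + t)⁻¹))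

/-- A positive semidefinite matrix dominates a positive multiple of any other one whose kernel
is at least as large. -/
lemma Matrix.PosSemidef.exists_sub_smul {P Q : Matrix n n ℂ} (hP : P.PosSemidef)
    (hQ : Q.PosSemidef) (h : ∀ v, P *ᵥ v = 0 → Q *ᵥ v = 0) :
    ∃ ε : ℝ, 0 < ε ∧ (P - (ε : ℂ) • Q).PosSemidef := by
  set U := (hP.1.eigenvectorUnitary : Matrix n n ℂ) with hU
  set d := hP.1.eigenvalues with hd
  have hd0 : ∀ i, 0 ≤ d i := hP.eigenvalues_nonneg
  have hUU : U * Uᴴ = 1 := hP.1.eigenvectorUnitary_mul_conjTranspose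
  set S : Matrix n n ℂ := diagonal fun i => (√(d i) : ℂ) with hS
  set E : Matrix n n ℂ := diagonal fun i => ((√(d i))⁻¹ : ℂ) with hE
  have hEH : Eᴴ = E := by
    rw [hE, diagonal_conjTranspose]; congr 1; ext i; simp
  have hSH : Sᴴ = S := by
    rw [hS, diagonal_conjTranspose]; congr 1; ext i; simp
  set Q' := Uᴴ * Q * U with hQ'
  have hQ'psd : Q'.PosSemidef := hQ.conjTranspose_mul_mul_same U
  have hcol : ∀ i j, d j = 0 → Q' i j = 0 := by
    intro i j hj
    have hv : P *ᵥ (fun k => U k j) = 0 := by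
      have := hP.1.mulVec_eigenvectorBasis j
      rw [← hd, hj, zero_smul] at this
      exact this
    have := h _ hv
    have h3 : Q' i j = (Uᴴ *ᵥ (Q *ᵥ fun k => U k j)) i := by
      rw [hQ', Matrix.mul_assoc]; rfl
    rw [h3, this]; simp
  have hrow : ∀ i j, d i = 0 → Q' i j = 0 := by
    intro i j hi
    rw [← hQ'psd.1.apply, hcol j i hi, star_zero]
  have hR : (E * Q' * E).PosSemidef := by
    have := hQ'psd.conjTranspose_mul_mul_same E
    rwa [hEH] at this
  obtain ⟨ε, hε, hpsd⟩ := hR.exists_one_sub_smul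
  refine ⟨ε, hε, ?_⟩
  have hSS : S * S = diagonal fun i => (d i : ℂ) := by
    rw [hS, diagonal_mul_diagonal]
    congr 1; ext i
    rw [← Complex.ofReal_mul, Real.mul_self_sqrt (hd0 i)]
  have hPeq : P = U * (S * S) * Uᴴ := by
    rw [hSS]; exact hP.1.eq_mul_diagonal_mul
  have hSQ : S * (E * Q' * E) * S = Q' := by
    ext i j
    rw [hS, hE, mul_diagonal, diagonal_mul, mul_diagonal, diagonal_mul]
    by_cases hi : d i = 0
    · simp [hrow i j hi]
    by_cases hj : d j = 0
    · simp [hcol i j hj]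
    have hi' : (√(d i) : ℂ) ≠ 0 :=
      Complex.ofReal_ne_zero.2 (Real.sqrt_ne_zero'.2 ((hd0 i).lt_of_ne' hi))
    have hj' : (√(d j) : ℂ) ≠ 0 :=
      Complex.ofReal_ne_zero.2 (Real.sqrt_ne_zero'.2 ((hd0 j).lt_of_ne' hj))
    field_simp
  have hQeq : Q = U * (S * (E * Q' * E) * S) * Uᴴ := by
    rw [hSQ, hQ']
    calc Q = (U * Uᴴ) * Q * (U * Uᴴ) := by rw [hUU]; simp
      _ = _ := by simp only [Matrix.mul_assoc]
  have hfin : P - (ε : ℂ) • Q = (U * S) * (1 - (ε : ℂ) • (E * Q' * E)) * (U * S)ᴴ := by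
    nth_rw 1 [hPeq, hQeq]
    rw [conjTranspose_mul, hSH]
    simp only [Matrix.mul_sub, Matrix.sub_mul, Matrix.mul_smul, Matrix.smul_mul, Matrix.mul_one,
      Matrix.mul_assoc]
  rw [hfin]
  exact hpsd.mul_mul_conjTranspose_same _

end General

/-- If all eigenvalues in an orthonormal eigenbasis but the one at `i` are nonzero, then the kernel
is spanned by the `i`-th eigenvector. -/
lemma OrthonormalBasis.exists_eq_smul_of_mulVec_eq_zero {n : Type*} [Fintype n]
    (V : OrthonormalBasis n ℂ (EuclideanSpace ℂ n)) {A : Matrix n n ℂ} {c : n → ℂ}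
    (hV : ∀ k, A *ᵥ ⇑(V k) = c k • ⇑(V k)) {i : n} (hi : ∀ k, k ≠ i → c k ≠ 0)
    {v : n → ℂ} (hv : A *ᵥ v = 0) : ∃ a : ℂ, v = a • ⇑(V i) := by
  set r := V.repr (WithLp.toLp 2 v) with hr
  have hsum : ∑ k, r k • V k = WithLp.toLp 2 v := V.sum_repr _
  have hsum' : v = ∑ k, r k • (⇑(V k) : n → ℂ) := by
    have := congrArg WithLp.ofLp hsum
    simpa using this.symm
  have h0 : ∑ k, (r k * c k) • V k = 0 := by
    apply WithLp.ofLp_injective 2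
    have : A *ᵥ v = ∑ k, (r k * c k) • (⇑(V k) : n → ℂ) := by
      rw [hsum', mulVec_sum]
      exact Finset.sum_congr rfl fun k _ => by rw [mulVec_smul, hV, smul_smul]
    rw [hv] at this
    simpa using this.symm
  have hli := Fintype.linearIndependent_iff.1 V.orthonormal.linearIndependent _ h0
  refine ⟨r i, ?_⟩
  rw [hsum']
  refine Finset.sum_eq_single i (fun k _ hk => ?_) (by simp)
  rw [(mul_eq_zero.1 (hli k)).resolve_right (hi k hk), zero_smul]

section Qubit

/-- A unit vector orthogonal to the unit vector `e` of `ℂ²`. -/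
def perpVec (e : Fin 2 → ℂ) : Fin 2 → ℂ := ![-star (e 1), star (e 0)]

/-- The rank-one matrix `e eᴴ`. -/
def rankOne {m : Type*} (e : m → ℂ) : Matrix m m ℂ := vecMulVec e (star e)

lemma perpVec_unit {e : Fin 2 → ℂ} (he : star e ⬝ᵥ e = 1) : star (perpVec e) ⬝ᵥ perpVec e = 1 := by
  simp only [dotProduct, Fin.sum_univ_two, perpVec, Pi.star_apply] at he ⊢
  simp only [cons_val_zero, cons_val_one, star_neg, star_star]
  linear_combination he

lemma rankOne_add_rankOne_perpVec {e : Fin 2 → ℂ} (he : star e ⬝ᵥ e = 1) :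
    rankOne e + rankOne (perpVec e) = 1 := by
  simp only [dotProduct, Fin.sum_univ_two, Pi.star_apply] at he
  ext i j
  rw [Matrix.add_apply, rankOne, rankOne, vecMulVec_apply, vecMulVec_apply]
  fin_cases i <;> fin_cases j <;> simp [perpVec, -RCLike.star_def, -Complex.star_def]
  · linear_combination he
  · ring
  · ring
  · linear_combination he

lemma posSemidef_rankOne {m : Type*} [Finite m] (e : m → ℂ) : (rankOne e).PosSemidef :=
  posSemidef_vecMulVec_self_star e

lemma isDensity_rankOne {m : Type*} [Fintype m] {e : m → ℂ} (he : star e ⬝ᵥ e = 1) :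
    IsDensity (rankOne e) := by
  refine ⟨posSemidef_rankOne e, ?_⟩
  rw [rankOne, trace_vecMulVec, dotProduct_comm, he]

lemma exists_normalize {m : Type*} [Fintype m] {v : m → ℂ} (hv : v ≠ 0) :
    ∃ c : ℂ, c ≠ 0 ∧ star (c • v) ⬝ᵥ (c • v) = 1 := by
  obtain ⟨t, ht, hvt⟩ : ∃ t : ℝ, 0 < t ∧ star v ⬝ᵥ v = t := by
    have h := dotProduct_star_self_pos_iff.2 hv
    exact ⟨_, (Complex.lt_def.1 h).1,
      Complex.ext (by simp) (by simpa using (Complex.lt_def.1 h).2.symm)⟩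
  have hs : (√t : ℂ) ≠ 0 := Complex.ofReal_ne_zero.2 (Real.sqrt_ne_zero'.2 ht)
  refine ⟨((√t)⁻¹ : ℂ), inv_ne_zero hs, ?_⟩
  have h2 : ((√t : ℝ) : ℂ) * √t = t := by rw [← Complex.ofReal_mul, Real.mul_self_sqrt ht.le]
  rw [star_smul, smul_dotProduct, dotProduct_smul, hvt, ← h2]
  simp [hs]

/-- A quadratic equation in projective form has a nontrivial complex solution. -/
lemma exists_ne_zero_quadratic_form_eq_zero (a b c : ℂ) :
    ∃ x y : ℂ, (x ≠ 0 ∨ y ≠ 0) ∧ a * x ^ 2 + b * x * y + c * y ^ 2 = 0 := by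
  by_cases ha : a = 0
  · exact ⟨1, 0, by simp, by simp [ha]⟩
  · obtain ⟨s, hs⟩ := IsAlgClosed.exists_eq_mul_self (discrim a b c)
    obtain ⟨x, hx⟩ := exists_quadratic_eq_zero ha ⟨s, hs⟩
    exact ⟨x, 1, by simp, by linear_combination hx⟩

/-- A matrix with zero trace has an isotropic vector. -/
lemma exists_ne_zero_isotropic (a b c : ℂ) :
    ∃ e : Fin 2 → ℂ, e ≠ 0 ∧
      e 0 * star (e 0) * a + e 0 * star (e 1) * b + e 1 * star (e 0) * c -
        e 1 * star (e 1) * a = 0 := by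
  by_cases ha : a = 0
  · refine ⟨![1, 0], fun h => by simpa using congrFun h 0, ?_⟩
    simp [ha]
  -- with `z` of modulus one such that `star z * b + z * c` is a real multiple of `a`,
  -- look for the vector in the form `(1, y z)` with `y` real
  obtain ⟨z, hz, s, hs⟩ : ∃ z : ℂ, z * star z = 1 ∧ ∃ s : ℝ, star z * b + z * c = s * a := by
    suffices ∃ z : ℂ, z * star z = 1 ∧
        (star z * (b / a) + z * (c / a)) = star (star z * (b / a) + z * (c / a)) by
      obtain ⟨z, hz, h⟩ := this
      refine ⟨z, hz, (star z * (b / a) + z * (c / a)).re, ?_⟩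
      rw [Complex.conj_eq_iff_re.1 h.symm]
      field_simp
    set κ := c / a - star (b / a) with hκ
    by_cases h0 : κ = 0
    · refine ⟨1, by simp, ?_⟩
      have : c / a = star (b / a) := sub_eq_zero.1 h0
      rw [this]; simp [-RCLike.star_def, add_comm]
    · have hn : (‖κ‖ : ℂ) ≠ 0 := by simpa using h0
      have hnn : κ * star κ = ‖κ‖ * ‖κ‖ := by
        rw [← sq]; exact Complex.mul_conj' κ
      have hns : star (‖κ‖ : ℂ) = ‖κ‖ := Complex.conj_ofReal _
      refine ⟨star κ / ‖κ‖, ?_, ?_⟩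
      · rw [star_div₀, star_star, hns]; field_simp; linear_combination hnn
      · simp only [star_add, star_mul', star_div₀, star_star, hns]
        have e1 : c / a = κ + star (b / a) := by rw [hκ]; ring
        have e2 : star c / star a = star κ + b / a := by
          have := congrArg star e1
          simpa [-RCLike.star_def] using this
        rw [e1, e2, star_div₀]
        ring
  set y : ℝ := (s + √(s ^ 2 + 4)) / 2 with hy
  have hyy : y ^ 2 - s * y - 1 = 0 := by
    have := Real.sq_sqrt (show 0 ≤ s ^ 2 + 4 by positivity)
    rw [hy]; linear_combination this / 4
  have hyc : (y : ℂ) ^ 2 - s * y - 1 = 0 := by exact_mod_cast hyy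
  refine ⟨![1, y * z], fun h => by simpa using congrFun h 0, ?_⟩
  have hys : star (y : ℂ) = y := Complex.conj_ofReal _
  simp only [cons_val_zero, cons_val_one, star_mul', hys, star_one]
  linear_combination (y : ℂ) * hs - (y : ℂ) ^ 2 * a * hz - a * hyc

/-- For orthogonal `N, X ∈ ℂ²` there is a unit vector orthogonal to `N` whose orthogonal
complement is orthogonal to `X`. -/
lemma exists_unit_orthogonal {N X : Fin 2 → ℂ} (h : star X ⬝ᵥ N = 0) :
    ∃ f : Fin 2 → ℂ, star f ⬝ᵥ f = 1 ∧ star f ⬝ᵥ N = 0 ∧ star (perpVec f) ⬝ᵥ X = 0 := by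
  suffices ∃ f : Fin 2 → ℂ, f ≠ 0 ∧ star f ⬝ᵥ N = 0 ∧ star (perpVec f) ⬝ᵥ X = 0 by
    obtain ⟨f, hf, hN, hX⟩ := this
    obtain ⟨c, -, hc⟩ := exists_normalize hf
    refine ⟨c • f, hc, by rw [star_smul, smul_dotProduct, hN, smul_zero], ?_⟩
    have : perpVec (c • f) = star c • perpVec f := by
      ext i; fin_cases i <;> simp [perpVec, -RCLike.star_def, star_mul']
    rw [this, star_smul, smul_dotProduct, hX, smul_zero]
  by_cases hX : X = 0
  · by_cases hN : N = 0
    · exact ⟨![1, 0], fun h => by simpa using congrFun h 0, by simp [hN], by simp [hX]⟩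
    · refine ⟨perpVec N, fun h0 => hN ?_, ?_, by simp [hX]⟩
      · ext i
        fin_cases i
        · simpa [perpVec] using congrFun h0 1
        · simpa [perpVec] using congrFun h0 0
      · simp [dotProduct, perpVec, -RCLike.star_def]; ring
  · refine ⟨X, hX, h, ?_⟩
    simp [dotProduct, perpVec, -RCLike.star_def]; ring

/-- The product vector `e ⊗ f`. -/
def prodVec (e f : Fin 2 → ℂ) : Fin 2 × Fin 2 → ℂ := fun p => e p.1 * f p.2

lemma rankOne_kronecker_mulVec (e f : Fin 2 → ℂ) (v : Fin 2 × Fin 2 → ℂ) :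
    (rankOne e ⊗ₖ rankOne f) *ᵥ v =
      (star f ⬝ᵥ fun k => star e ⬝ᵥ fun i => v (i, k)) • prodVec e f := by
  ext ⟨i, k⟩
  simp only [mulVec, dotProduct, kronecker_apply, rankOne, vecMulVec_apply, prodVec, Pi.smul_apply,
    smul_eq_mul, Fintype.sum_prod_type, Fin.sum_univ_two, Pi.star_apply]
  ring

/-- For orthogonal `ν` and `ξ` there is an orthonormal basis `e, e'` of `ℂ²` and unit vectors `f, g`
such that `e ⊗ f`, `e' ⊗ g` are orthogonal to `ν` and `e ⊗ f'`, `e' ⊗ g'` are orthogonal to `ξ`. -/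
lemma exists_product_vectors {ν ξ : Fin 2 × Fin 2 → ℂ} (h : star ν ⬝ᵥ ξ = 0) :
    ∃ e f g : Fin 2 → ℂ, star e ⬝ᵥ e = 1 ∧ star f ⬝ᵥ f = 1 ∧ star g ⬝ᵥ g = 1 ∧
      (rankOne e ⊗ₖ rankOne f) *ᵥ ν = 0 ∧
      (rankOne (perpVec e) ⊗ₖ rankOne g) *ᵥ ν = 0 ∧
      (rankOne e ⊗ₖ rankOne (perpVec f)) *ᵥ ξ = 0 ∧
      (rankOne (perpVec e) ⊗ₖ rankOne (perpVec g)) *ᵥ ξ = 0 := by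
  have hG : ∑ k, ν (1, k) * star (ξ (1, k)) = - ∑ k, ν (0, k) * star (ξ (0, k)) := by
    have := congrArg star h
    simp only [dotProduct, Fintype.sum_prod_type, Fin.sum_univ_two, Pi.star_apply, star_add,
      star_mul', star_star, star_zero] at this ⊢
    linear_combination this
  obtain ⟨e₀, he₀, hiso₀⟩ := exists_ne_zero_isotropic (∑ k, ν (0, k) * star (ξ (0, k)))
    (∑ k, star (ξ (0, k)) * ν (1, k)) (∑ k, star (ξ (1, k)) * ν (0, k))
  obtain ⟨c, -, he⟩ := exists_normalize he₀
  set e := c • e₀ with hec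
  have hiso : star (fun k => star e ⬝ᵥ fun i => ξ (i, k)) ⬝ᵥ
      (fun k => star e ⬝ᵥ fun i => ν (i, k)) = 0 := by
    simp only [hec, dotProduct, Fin.sum_univ_two, Pi.star_apply, star_add, star_mul', star_star,
      Pi.smul_apply, smul_eq_mul] at hG hiso₀ ⊢
    linear_combination c * star c * hiso₀ + c * star c * e₀ 1 * star (e₀ 1) * hG
  have hiso' : star (fun k => star (perpVec e) ⬝ᵥ fun i => ξ (i, k)) ⬝ᵥ
      (fun k => star (perpVec e) ⬝ᵥ fun i => ν (i, k)) = 0 := by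
    simp only [hec, perpVec, dotProduct, Fin.sum_univ_two, Pi.star_apply, star_add, star_mul',
      star_star, Pi.smul_apply, smul_eq_mul, cons_val_zero, cons_val_one, star_neg] at hG hiso₀ ⊢
    linear_combination - c * star c * hiso₀ + c * star c * e₀ 0 * star (e₀ 0) * hG
  obtain ⟨f, hf, hfN, hfX⟩ := exists_unit_orthogonal hiso
  obtain ⟨g, hg, hgN, hgX⟩ := exists_unit_orthogonal hiso'
  refine ⟨e, f, g, he, hf, hg, ?_, ?_, ?_, ?_⟩ <;> rw [rankOne_kronecker_mulVec]
  · rw [hfN, zero_smul]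
  · rw [hgN, zero_smul]
  · rw [hfX, zero_smul]
  · rw [hgX, zero_smul]

end Qubit

section Separable

lemma trace_ptrace2 (ρ : Matrix (Fin 2 × Fin 2) (Fin 2 × Fin 2) ℂ) :
    (ptrace2 ρ).trace = ρ.trace := by
  simp [ptrace2, trace, Fintype.sum_prod_type]

lemma ptrace2_add (ρ σ : Matrix (Fin 2 × Fin 2) (Fin 2 × Fin 2) ℂ) :
    ptrace2 (ρ + σ) = ptrace2 ρ + ptrace2 σ := by
  ext i j; simp [ptrace2, Finset.sum_add_distrib]

lemma ptrace2_smul (c : ℂ) (ρ : Matrix (Fin 2 × Fin 2) (Fin 2 × Fin 2) ℂ) :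
    ptrace2 (c • ρ) = c • ptrace2 ρ := by
  ext i j; simp [ptrace2]; ring

lemma ptrace2_sub (ρ σ : Matrix (Fin 2 × Fin 2) (Fin 2 × Fin 2) ℂ) :
    ptrace2 (ρ - σ) = ptrace2 ρ - ptrace2 σ := by
  ext i j; simp [ptrace2, Finset.sum_sub_distrib]

lemma ptrace2_kronecker (σ τ : Matrix (Fin 2) (Fin 2) ℂ) :
    ptrace2 (σ ⊗ₖ τ) = τ.trace • σ := by
  ext i j; simp [ptrace2, trace]; ring

lemma ptrace2_sum {ι : Type*} (s : Finset ι)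
    (f : ι → Matrix (Fin 2 × Fin 2) (Fin 2 × Fin 2) ℂ) :
    ptrace2 (∑ k ∈ s, f k) = ∑ k ∈ s, ptrace2 (f k) := by
  ext i j
  simp only [ptrace2, Matrix.sum_apply]
  exact Finset.sum_comm

lemma separableState_kronecker {σ τ : Matrix (Fin 2) (Fin 2) ℂ} (hσ : IsDensity σ)
    (hτ : IsDensity τ) : SeparableState (σ ⊗ₖ τ) :=
  ⟨1, le_rfl, fun _ => 1, fun _ => σ, fun _ => τ, by simp, by simp, fun _ => hσ, fun _ => hτ,
    by simp⟩

lemma SeparableState.convex_comb {ρ ρ' : Matrix (Fin 2 × Fin 2) (Fin 2 × Fin 2) ℂ}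
    (h : SeparableState ρ) (h' : SeparableState ρ') {a b : ℝ} (ha : 0 ≤ a) (hb : 0 ≤ b)
    (hab : a + b = 1) : SeparableState ((a : ℂ) • ρ + (b : ℂ) • ρ') := by
  obtain ⟨K, hK, w, σ, τ, hw, hw1, hσ, hτ, rfl⟩ := h
  obtain ⟨K', -, w', σ', τ', hw', hw1', hσ', hτ', rfl⟩ := h'
  refine ⟨K + K', by omega, Fin.append (fun k => a * w k) (fun k => b * w' k), Fin.append σ σ',
    Fin.append τ τ', fun k => ?_, ?_, fun k => ?_, fun k => ?_, ?_⟩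
  · refine Fin.addCases (fun k => ?_) (fun k => ?_) k
    · simpa using mul_nonneg ha (hw k)
    · simpa using mul_nonneg hb (hw' k)
  · simp [Fin.sum_univ_add, ← Finset.mul_sum, hw1, hw1', hab]
  · refine Fin.addCases (fun k => ?_) (fun k => ?_) k
    · simpa using hσ k
    · simpa using hσ' k
  · refine Fin.addCases (fun k => ?_) (fun k => ?_) k
    · simpa using hτ k
    · simpa using hτ' k
  · simp [Fin.sum_univ_add, Finset.smul_sum, smul_smul]

/-- The reduction criterion for separable states. -/
lemma SeparableState.posSemidef_ptrace2_kronecker_one_sub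
    {ρ : Matrix (Fin 2 × Fin 2) (Fin 2 × Fin 2) ℂ} (h : SeparableState ρ) :
    (ptrace2 ρ ⊗ₖ (1 : Matrix (Fin 2) (Fin 2) ℂ) - ρ).PosSemidef := by
  obtain ⟨K, -, w, σ, τ, hw, -, hσ, hτ, rfl⟩ := h
  have : ptrace2 (∑ k, (w k : ℂ) • (σ k ⊗ₖ τ k)) ⊗ₖ (1 : Matrix (Fin 2) (Fin 2) ℂ) -
      ∑ k, (w k : ℂ) • (σ k ⊗ₖ τ k) =
      ∑ k, (w k : ℂ) • (σ k ⊗ₖ ((τ k).trace • (1 : Matrix (Fin 2) (Fin 2) ℂ) - τ k)) := by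
    rw [ptrace2_sum]
    simp only [ptrace2_smul, ptrace2_kronecker]
    ext ⟨i, k⟩ ⟨j, l⟩
    simp only [Matrix.sub_apply, kronecker_apply, Matrix.sum_apply, Matrix.smul_apply, smul_eq_mul,
      Finset.sum_mul, ← Finset.sum_sub_distrib]
    exact Finset.sum_congr rfl fun _ _ => by ring
  rw [this]
  exact posSemidef_sum _ fun k _ => ((hσ k).1.kronecker (hτ k).1.trace_smul_one_sub).smul
    (Complex.zero_le_real.2 (hw k))

/-- The positive semidefinite matrices bounded by `1/2` with partial trace `1/2`. -/
structure IsHalfBounded (ρ : Matrix (Fin 2 × Fin 2) (Fin 2 × Fin 2) ℂ) : Prop where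
  posSemidef : ρ.PosSemidef
  posSemidef_sub : ((1 / 2 : ℂ) • 1 - ρ).PosSemidef
  ptrace2_eq : ptrace2 ρ = (1 / 2 : ℂ) • (1 : Matrix (Fin 2) (Fin 2) ℂ)

lemma IsHalfBounded.trace_eq {ρ : Matrix (Fin 2 × Fin 2) (Fin 2 × Fin 2) ℂ}
    (h : IsHalfBounded ρ) : ρ.trace = 1 := by
  rw [← trace_ptrace2, h.ptrace2_eq]; simp

lemma exists_prodVec_of_det_eq_zero {w : Fin 2 × Fin 2 → ℂ}
    (hw : w (0, 0) * w (1, 1) = w (0, 1) * w (1, 0)) : ∃ u v, w = prodVec u v := by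
  by_cases h0 : w (0, 0) = 0
  · by_cases h1 : w (0, 1) = 0
    · refine ⟨![0, 1], fun k => w (1, k), ?_⟩
      ext ⟨i, k⟩
      fin_cases i <;> fin_cases k <;> simp [prodVec, h0, h1]
    · refine ⟨![1, w (1, 1) / w (0, 1)], fun k => w (0, k), ?_⟩
      have h2 : w (1, 0) = 0 := by
        rw [h0, zero_mul] at hw
        exact (mul_eq_zero.1 hw.symm).resolve_left h1
      ext ⟨i, k⟩
      fin_cases i <;> fin_cases k <;> simp [prodVec, h0, h1, h2]
  · refine ⟨![1, w (1, 0) / w (0, 0)], fun k => w (0, k), ?_⟩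
    ext ⟨i, k⟩
    fin_cases i <;> fin_cases k <;> simp [prodVec, h0]
    field_simp
    linear_combination hw

/-- A two-dimensional subspace of `ℂ² ⊗ ℂ²` contains a product vector. -/
lemma exists_prodVec_eq_combination (x y : Fin 2 × Fin 2 → ℂ) :
    ∃ a b : ℂ, (a ≠ 0 ∨ b ≠ 0) ∧ ∃ u v, a • x + b • y = prodVec u v := by
  obtain ⟨a, b, hab, h⟩ := exists_ne_zero_quadratic_form_eq_zero
    (x (0, 0) * x (1, 1) - x (0, 1) * x (1, 0))
    (x (0, 0) * y (1, 1) + y (0, 0) * x (1, 1) - x (0, 1) * y (1, 0) - y (0, 1) * x (1, 0))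
    (y (0, 0) * y (1, 1) - y (0, 1) * y (1, 0))
  refine ⟨a, b, hab, exists_prodVec_of_det_eq_zero ?_⟩
  simp only [Pi.add_apply, Pi.smul_apply, smul_eq_mul]
  linear_combination h

lemma Matrix.PosSemidef.sub_smul_rankOne {n : Type*} [Fintype n] [DecidableEq n]
    {A : Matrix n n ℂ} (hA : A.PosSemidef) {w : n → ℂ} (hw : star w ⬝ᵥ w = 1) {c : ℝ}
    (h : A *ᵥ w = (c : ℂ) • w) : (A - (c : ℂ) • rankOne w).PosSemidef := by
  have hP : (1 - rankOne w)ᴴ = 1 - rankOne w := by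
    rw [conjTranspose_sub, conjTranspose_one, (posSemidef_rankOne w).1]
  have h1 : A * rankOne w = (c : ℂ) • rankOne w := by
    rw [rankOne, mul_vecMulVec, h, smul_vecMulVec]
  have h2 : rankOne w * A = (c : ℂ) • rankOne w := by
    have := congrArg Matrix.conjTranspose h1
    rw [conjTranspose_mul, conjTranspose_smul, hA.1, (posSemidef_rankOne w).1] at this
    rw [this]; simp
  have h3 : rankOne w * rankOne w = rankOne w := by
    rw [rankOne, vecMulVec_mul_vecMulVec, hw]; simp
  have : A - (c : ℂ) • rankOne w = (1 - rankOne w)ᴴ * A * (1 - rankOne w) := by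
    rw [hP, sub_mul, one_mul, h2, mul_sub, mul_one, sub_mul, h1, smul_mul_assoc, h3, sub_self,
      sub_zero]
  rw [this]
  exact hA.conjTranspose_mul_mul_same _

/-- A positive semidefinite matrix whose partial trace annihilates the unit vector `u` is a
product. -/
lemma Matrix.PosSemidef.exists_eq_rankOne_perpVec_kronecker
    {M : Matrix (Fin 2 × Fin 2) (Fin 2 × Fin 2) ℂ} (hM : M.PosSemidef) {u : Fin 2 → ℂ}
    (hu : star u ⬝ᵥ u = 1) (h : star u ⬝ᵥ (ptrace2 M *ᵥ u) = 0) :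
    ∃ C : Matrix (Fin 2) (Fin 2) ℂ, C.PosSemidef ∧ M = rankOne (perpVec u) ⊗ₖ C := by
  obtain ⟨m, b, rfl⟩ := posSemidef_iff_eq_sum_vecMulVec.1 hM
  set y : Fin m → Fin 2 → ℂ := fun r k => star u ⬝ᵥ fun i => b r (i, k) with hy
  have hyeq : star u ⬝ᵥ (ptrace2 (∑ r, vecMulVec (b r) (star (b r))) *ᵥ u) =
      ∑ r, ∑ k, y r k * star (y r k) := by
    rw [ptrace2_sum, sum_mulVec, dotProduct_sum]
    refine Finset.sum_congr rfl fun r _ => ?_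
    simp only [hy, ptrace2, mulVec, dotProduct, vecMulVec_apply, Fin.sum_univ_two, Pi.star_apply,
      star_add, star_mul', star_star]
    ring
  have hy0 : ∀ r k, y r k = 0 := by
    rw [hyeq, Finset.sum_eq_zero_iff_of_nonneg
      (fun r _ => Finset.sum_nonneg fun k _ => mul_star_self_nonneg _)] at h
    intro r k
    have := (Finset.sum_eq_zero_iff_of_nonneg (fun k _ => mul_star_self_nonneg _)).1
      (h r (Finset.mem_univ _)) k (Finset.mem_univ _)
    simpa using this
  set c : Fin m → Fin 2 → ℂ := fun r k => star (perpVec u) ⬝ᵥ fun i => b r (i, k) with hc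
  have hb : ∀ r, b r = prodVec (perpVec u) (c r) := by
    intro r
    ext ⟨i, k⟩
    have h1 := congrFun (congrArg (· *ᵥ fun i => b r (i, k)) (rankOne_add_rankOne_perpVec hu)) i
    simp only [add_mulVec, rankOne, vecMulVec_mulVec, one_mulVec, Pi.add_apply, Pi.smul_apply,
      MulOpposite.smul_eq_mul_unop, MulOpposite.unop_op] at h1
    have h2 := hy0 r k
    rw [hy] at h2
    simp only at h2
    rw [h2, mul_zero, zero_add] at h1
    exact h1.symm
  refine ⟨∑ r, rankOne (c r), posSemidef_sum _ fun r _ => posSemidef_rankOne _, ?_⟩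
  ext ⟨i, k⟩ ⟨j, l⟩
  simp only [Matrix.sum_apply, kronecker_apply, Finset.mul_sum]
  refine Finset.sum_congr rfl fun r _ => ?_
  rw [hb r]
  simp only [rankOne, vecMulVec_apply, prodVec, Pi.star_apply, star_mul']
  ring

lemma IsHalfBounded.separableState_of_mulVec_prodVec
    {ρ : Matrix (Fin 2 × Fin 2) (Fin 2 × Fin 2) ℂ} (h : IsHalfBounded ρ) {u v : Fin 2 → ℂ}
    (huv : prodVec u v ≠ 0) (hρ : ρ *ᵥ prodVec u v = (1 / 2 : ℂ) • prodVec u v) :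
    SeparableState ρ := by
  have hu : u ≠ 0 := by rintro rfl; exact huv (by ext; simp [prodVec])
  have hv : v ≠ 0 := by rintro rfl; exact huv (by ext; simp [prodVec])
  obtain ⟨a, -, hu1⟩ := exists_normalize hu
  obtain ⟨b, -, hv1⟩ := exists_normalize hv
  set u' := a • u
  set v' := b • v
  have hw : prodVec u' v' = (a * b) • prodVec u v := by
    ext; simp [prodVec, u', v']; ring
  have hunit : star (prodVec u' v') ⬝ᵥ prodVec u' v' = 1 := by
    simp only [dotProduct, Fintype.sum_prod_type, Fin.sum_univ_two, prodVec, Pi.star_apply,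
      star_mul'] at hu1 hv1 ⊢
    linear_combination hu1 * (star (v' 0) * v' 0 + star (v' 1) * v' 1) + hv1
  have hkron : rankOne (prodVec u' v') = rankOne u' ⊗ₖ rankOne v' := by
    ext ⟨i, k⟩ ⟨j, l⟩
    simp only [rankOne, vecMulVec_apply, prodVec, kronecker_apply, Pi.star_apply, star_mul']
    ring
  have hM : (ρ - (1 / 2 : ℂ) • (rankOne u' ⊗ₖ rankOne v')).PosSemidef := by
    have := h.posSemidef.sub_smul_rankOne hunit (c := 1 / 2) (by
      rw [hw, mulVec_smul, hρ, smul_comm]; simp)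
    rw [hkron] at this
    simpa using this
  obtain ⟨C, hC, hMC⟩ := hM.exists_eq_rankOne_perpVec_kronecker hu1 (by
    rw [ptrace2_sub, ptrace2_smul, ptrace2_kronecker, (isDensity_rankOne hv1).2, h.ptrace2_eq,
      one_smul, sub_mulVec, smul_mulVec, smul_mulVec, one_mulVec, rankOne, vecMulVec_mulVec,
      hu1]
    simp)
  have hCtr : C.trace = 1 / 2 := by
    have := congrArg trace hMC
    rw [trace_sub, trace_smul, trace_kronecker, trace_kronecker, h.trace_eq,
      (isDensity_rankOne hu1).2, (isDensity_rankOne hv1).2,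
      (isDensity_rankOne (perpVec_unit hu1)).2, one_mul, one_mul] at this
    rw [← this]; norm_num
  have hC2 : IsDensity ((2 : ℂ) • C) :=
    ⟨hC.smul (by norm_num), by rw [trace_smul, hCtr]; norm_num⟩
  have := (separableState_kronecker (isDensity_rankOne hu1) (isDensity_rankOne hv1)).convex_comb
    (separableState_kronecker (isDensity_rankOne (perpVec_unit hu1)) hC2)
    (a := 1 / 2) (b := 1 / 2) (by norm_num) (by norm_num) (by norm_num)
  convert this using 1
  rw [kronecker_smul, ← hMC, smul_smul]
  norm_num

lemma exists_two_halves_or_unique_extremes {d : Fin 2 × Fin 2 → ℝ}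
    (h1 : ∀ k, d k ≤ 1 / 2) (hsum : ∑ k, d k = 1) :
    (∃ i j, i ≠ j ∧ d i = 1 / 2 ∧ d j = 1 / 2) ∨
      ∃ i j, i ≠ j ∧ (∀ k, k ≠ i → d k ≠ 0) ∧ ∀ k, k ≠ j → d k ≠ 1 / 2 := by
  by_cases H : ∃ i j, i ≠ j ∧ d i = 1 / 2 ∧ d j = 1 / 2
  · exact Or.inl H
  right
  push Not at H
  have hz : ∀ i j, i ≠ j → d i = 0 → d j ≠ 0 := by
    intro i j hij hi hj
    have ha := h1 (0, 0)
    have hb := h1 (0, 1)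
    have hc := h1 (1, 0)
    have hd := h1 (1, 1)
    simp only [Fintype.sum_prod_type, Fin.sum_univ_two] at hsum
    obtain ⟨k, l, hkl, hk, hl⟩ : ∃ k l, k ≠ l ∧ d k = 1 / 2 ∧ d l = 1 / 2 := by
      fin_cases i <;> fin_cases j <;> simp at hij hi hj
      · exact ⟨(1, 0), (1, 1), by simp, by linarith, by linarith⟩
      · exact ⟨(0, 1), (1, 1), by simp, by linarith, by linarith⟩
      · exact ⟨(0, 1), (1, 0), by simp, by linarith, by linarith⟩
      · exact ⟨(1, 0), (1, 1), by simp, by linarith, by linarith⟩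
      · exact ⟨(0, 0), (1, 1), by simp, by linarith, by linarith⟩
      · exact ⟨(0, 0), (1, 0), by simp, by linarith, by linarith⟩
      · exact ⟨(0, 1), (1, 1), by simp, by linarith, by linarith⟩
      · exact ⟨(0, 0), (1, 1), by simp, by linarith, by linarith⟩
      · exact ⟨(0, 0), (0, 1), by simp, by linarith, by linarith⟩
      · exact ⟨(0, 1), (1, 0), by simp, by linarith, by linarith⟩
      · exact ⟨(0, 0), (1, 0), by simp, by linarith, by linarith⟩
      · exact ⟨(0, 0), (0, 1), by simp, by linarith, by linarith⟩
    exact H k l hkl hk hl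
  by_cases hi : ∃ i, d i = 0
  · obtain ⟨i, hi⟩ := hi
    by_cases hj : ∃ j, d j = 1 / 2
    · obtain ⟨j, hj⟩ := hj
      refine ⟨i, j, ?_, fun k hk => hz i k hk.symm hi, fun k hk => H j k hk.symm hj⟩
      rintro rfl
      norm_num [hi] at hj
    · push Not at hj
      obtain ⟨j, hij⟩ := exists_ne i
      exact ⟨i, j, hij.symm, fun k hk => hz i k hk.symm hi, fun k _ => hj k⟩
  · push Not at hi
    by_cases hj : ∃ j, d j = 1 / 2
    · obtain ⟨j, hj⟩ := hj
      obtain ⟨i, hij⟩ := exists_ne j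
      exact ⟨i, j, hij, fun k _ => hi k, fun k hk => H j k hk.symm hj⟩
    · push Not at hj
      exact ⟨(0, 0), (0, 1), by simp, fun k _ => hi k, fun k _ => hj k⟩

lemma IsHalfBounded.separableState_or_exists_orthogonal
    {ρ : Matrix (Fin 2 × Fin 2) (Fin 2 × Fin 2) ℂ} (h : IsHalfBounded ρ) :
    SeparableState ρ ∨ ∃ ν ξ : Fin 2 × Fin 2 → ℂ, star ν ⬝ᵥ ξ = 0 ∧
      (∀ v, ρ *ᵥ v = 0 → ∃ a : ℂ, v = a • ν) ∧
      ∀ v, ((1 / 2 : ℂ) • 1 - ρ) *ᵥ v = 0 → ∃ a : ℂ, v = a • ξ := by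
  set V := h.posSemidef.1.eigenvectorBasis with hV
  set d := h.posSemidef.1.eigenvalues with hd
  have hρV : ∀ k, ρ *ᵥ ⇑(V k) = (d k : ℂ) • ⇑(V k) := fun k =>
    h.posSemidef.1.mulVec_eigenvectorBasis k
  have hρV' : ∀ k, ((1 / 2 : ℂ) • 1 - ρ) *ᵥ ⇑(V k) = (1 / 2 - d k : ℂ) • ⇑(V k) := fun k => by
    rw [sub_mulVec, smul_mulVec, one_mulVec, hρV, sub_smul]
  have horth : ∀ i j, star (V i : Fin 2 × Fin 2 → ℂ) ⬝ᵥ ⇑(V j) = if i = j then 1 else 0 := by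
    intro i j
    have := orthonormal_iff_ite.1 V.orthonormal i j
    rw [EuclideanSpace.inner_eq_star_dotProduct, dotProduct_comm] at this
    exact this
  have hle : ∀ k, d k ≤ 1 / 2 := by
    intro k
    have := h.posSemidef_sub.dotProduct_mulVec_nonneg (V k)
    rw [hρV', dotProduct_smul, horth, if_pos rfl, smul_eq_mul, mul_one] at this
    have h2 := (Complex.le_def.1 this).1
    simp at h2
    linarith
  have hsum : ∑ k, d k = 1 := by
    have h1 := h.posSemidef.1.trace_eq_sum_eigenvalues
    rw [h.trace_eq, ← hd] at h1
    simp only [RCLike.ofReal_eq_complex_ofReal] at h1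
    exact_mod_cast h1.symm
  rcases exists_two_halves_or_unique_extremes hle hsum with
    ⟨i, j, hij, hi, hj⟩ | ⟨i, j, hij, hi, hj⟩
  · left
    obtain ⟨a, b, hab, u, v, huv⟩ := exists_prodVec_eq_combination (V i) (V j)
    refine h.separableState_of_mulVec_prodVec (u := u) (v := v) (fun h0 => ?_) ?_
    · rw [← huv] at h0
      have ha := congrArg (star (V i : Fin 2 × Fin 2 → ℂ) ⬝ᵥ ·) h0
      have hb := congrArg (star (V j : Fin 2 × Fin 2 → ℂ) ⬝ᵥ ·) h0
      simp [dotProduct_add, dotProduct_smul, horth, hij, hij.symm] at ha hb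
      simp [ha, hb] at hab
    · rw [← huv, mulVec_add, mulVec_smul, mulVec_smul, hρV, hρV, hi, hj, smul_add]
      simp only [smul_smul]
      push_cast
      rw [mul_comm a, mul_comm b]
  · right
    refine ⟨V i, V j, by rw [horth, if_neg hij], fun v hv => ?_, fun v hv => ?_⟩
    · exact V.exists_eq_smul_of_mulVec_eq_zero hρV
        (fun k hk => Complex.ofReal_ne_zero.2 (hi k hk)) hv
    · refine V.exists_eq_smul_of_mulVec_eq_zero hρV' (fun k hk h0 => hj k hk ?_) hv
      have : (d k : ℂ) = ((1 / 2 : ℝ) : ℂ) := by push_cast; linear_combination -h0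
      exact_mod_cast this

/-- For orthogonal `ν` and `ξ` there is a separable half-bounded state with `ν` in its kernel and
`ξ` an eigenvector of eigenvalue `1/2`. -/
lemma exists_separableState_isHalfBounded {ν ξ : Fin 2 × Fin 2 → ℂ} (h : star ν ⬝ᵥ ξ = 0) :
    ∃ τ, IsHalfBounded τ ∧ SeparableState τ ∧ τ *ᵥ ν = 0 ∧
      ((1 / 2 : ℂ) • 1 - τ) *ᵥ ξ = 0 := by
  obtain ⟨e, f, g, he, hf, hg, h1, h2, h3, h4⟩ := exists_product_vectors h
  have hhalf : (0 : ℂ) ≤ 1 / 2 := by simp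
  set τ := (1 / 2 : ℂ) • (rankOne e ⊗ₖ rankOne f + rankOne (perpVec e) ⊗ₖ rankOne g) with hτ
  have hone : (1 / 2 : ℂ) • 1 - τ = (1 / 2 : ℂ) •
      (rankOne e ⊗ₖ rankOne (perpVec f) + rankOne (perpVec e) ⊗ₖ rankOne (perpVec g)) := by
    rw [hτ, ← smul_sub]
    congr 1
    rw [sub_eq_iff_eq_add]
    calc (1 : Matrix (Fin 2 × Fin 2) (Fin 2 × Fin 2) ℂ)
        = rankOne e ⊗ₖ (rankOne f + rankOne (perpVec f)) +
          rankOne (perpVec e) ⊗ₖ (rankOne g + rankOne (perpVec g)) := by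
          rw [rankOne_add_rankOne_perpVec hf, rankOne_add_rankOne_perpVec hg, ← add_kronecker,
            rankOne_add_rankOne_perpVec he, one_kronecker_one]
      _ = _ := by rw [kronecker_add, kronecker_add]; abel
  refine ⟨τ, ⟨?_, ?_, ?_⟩, ?_, ?_, ?_⟩
  · exact (((posSemidef_rankOne _).kronecker (posSemidef_rankOne _)).add
      ((posSemidef_rankOne _).kronecker (posSemidef_rankOne _))).smul hhalf
  · rw [hone]
    exact (((posSemidef_rankOne _).kronecker (posSemidef_rankOne _)).add
      ((posSemidef_rankOne _).kronecker (posSemidef_rankOne _))).smul hhalf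
  · rw [hτ, ptrace2_smul, ptrace2_add, ptrace2_kronecker, ptrace2_kronecker,
      (isDensity_rankOne hf).2, (isDensity_rankOne hg).2, one_smul, one_smul,
      rankOne_add_rankOne_perpVec he]
  · have := (separableState_kronecker (isDensity_rankOne he) (isDensity_rankOne hf)).convex_comb
      (separableState_kronecker (isDensity_rankOne (perpVec_unit he)) (isDensity_rankOne hg))
      (a := 1 / 2) (b := 1 / 2) (by norm_num) (by norm_num) (by norm_num)
    convert this using 1
    rw [hτ, smul_add]
    norm_num
  · rw [hτ, smul_mulVec, add_mulVec, h1, h2, add_zero, smul_zero]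
  · rw [hone, smul_mulVec, add_mulVec, h3, h4, add_zero, smul_zero]

lemma isClosed_setOf_posSemidef_add_smul {n : Type*} [Fintype n] {A B : Matrix n n ℂ}
    (hA : A.IsHermitian) (hB : B.IsHermitian) :
    IsClosed {t : ℝ | (A + (t : ℂ) • B).PosSemidef} := by
  have : {t : ℝ | (A + (t : ℂ) • B).PosSemidef} =
      ⋂ x : n → ℂ, {t : ℝ | 0 ≤ star x ⬝ᵥ (A *ᵥ x) + (t : ℂ) * (star x ⬝ᵥ (B *ᵥ x))} := by
    ext t
    have hH : (A + (t : ℂ) • B).IsHermitian := by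
      rw [IsHermitian, conjTranspose_add, conjTranspose_smul, hA, hB]; simp
    simp only [Set.mem_ofPred_eq, Set.mem_iInter, posSemidef_iff_dotProduct_mulVec, hH, true_and,
      add_mulVec, smul_mulVec, dotProduct_add, dotProduct_smul, smul_eq_mul]
  rw [this]
  exact isClosed_iInter fun x => isClosed_le continuous_const (by fun_prop)

lemma bddAbove_setOf_posSemidef_add_smul {n : Type*} [Fintype n] {A B : Matrix n n ℂ}
    (hB : B.IsHermitian) (htr : B.trace = 0) (hB0 : B ≠ 0) :
    BddAbove {t : ℝ | (A + (t : ℂ) • B).PosSemidef} := by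
  obtain ⟨x, hx⟩ : ∃ x : n → ℂ, (star x ⬝ᵥ (B *ᵥ x)).re < 0 := by
    by_contra! H
    refine hB0 ((PosSemidef.trace_eq_zero_iff (.of_dotProduct_mulVec_nonneg hB fun x => ?_)).1 htr)
    refine Complex.le_def.2 ⟨H x, ?_⟩
    exact (hB.im_star_dotProduct_mulVec_self x).symm
  refine ⟨(star x ⬝ᵥ (A *ᵥ x)).re / -(star x ⬝ᵥ (B *ᵥ x)).re, fun t ht => ?_⟩
  have := (Complex.le_def.1 (ht.dotProduct_mulVec_nonneg x)).1
  rw [add_mulVec, smul_mulVec, dotProduct_add, dotProduct_smul] at this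
  simp at this
  rw [le_div_iff₀ (by linarith)]
  linarith

lemma Matrix.PosSemidef.sub_smul_of_le {n : Type*} {P Q : Matrix n n ℂ} {ε δ : ℝ}
    (h : (P - (ε : ℂ) • Q).PosSemidef) (hQ : Q.PosSemidef) (hδ : δ ≤ ε) :
    (P - (δ : ℂ) • Q).PosSemidef := by
  have : P - (δ : ℂ) • Q = (P - (ε : ℂ) • Q) + ((ε - δ : ℝ) : ℂ) • Q := by
    push_cast; module
  rw [this]
  exact h.add (hQ.smul (Complex.zero_le_real.2 (sub_nonneg.2 hδ)))

/-- The total dimension of the eigenspaces of `ρ` for the eigenvalues `0` and `1/2`. -/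
noncomputable def extremeDim (ρ : Matrix (Fin 2 × Fin 2) (Fin 2 × Fin 2) ℂ) : ℕ :=
  Module.finrank ℂ (LinearMap.ker ρ.mulVecLin) +
    Module.finrank ℂ (LinearMap.ker ((1 / 2 : ℂ) • 1 - ρ).mulVecLin)

lemma extremeDim_le (ρ : Matrix (Fin 2 × Fin 2) (Fin 2 × Fin 2) ℂ) : extremeDim ρ ≤ 8 := by
  have h1 := Submodule.finrank_le (LinearMap.ker ρ.mulVecLin)
  have h2 := Submodule.finrank_le (LinearMap.ker ((1 / 2 : ℂ) • 1 - ρ).mulVecLin)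
  simp only [Module.finrank_fintype_fun_eq_card, Fintype.card_prod, Fintype.card_fin] at h1 h2
  simp only [extremeDim]
  omega

/-- Moving from `τ` through `ρ` up to the boundary reaches a half-bounded state with larger
extreme eigenspaces. -/
lemma IsHalfBounded.exists_extremeDim_lt {ρ τ : Matrix (Fin 2 × Fin 2) (Fin 2 × Fin 2) ℂ}
    (hρ : IsHalfBounded ρ) (hτ : IsHalfBounded τ) (hne : ρ ≠ τ)
    (h0 : ∀ v, ρ *ᵥ v = 0 → τ *ᵥ v = 0)
    (h1 : ∀ v, ((1 / 2 : ℂ) • 1 - ρ) *ᵥ v = 0 → ((1 / 2 : ℂ) • 1 - τ) *ᵥ v = 0) :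
    ∃ m : ℝ, 0 ≤ m ∧ IsHalfBounded (ρ + (m : ℂ) • (ρ - τ)) ∧
      extremeDim ρ < extremeDim (ρ + (m : ℂ) • (ρ - τ)) := by
  have hH : (ρ - τ).IsHermitian := hρ.posSemidef.1.sub hτ.posSemidef.1
  have hsub : ∀ t : ℝ, (1 / 2 : ℂ) • 1 - (ρ + (t : ℂ) • (ρ - τ)) =
      ((1 / 2 : ℂ) • 1 - ρ) + (t : ℂ) • (((1 / 2 : ℂ) • 1 - ρ) - ((1 / 2 : ℂ) • 1 - τ)) := by
    intro t; module
  set E : Set ℝ := Set.Ici 0 ∩ {t : ℝ | (ρ + (t : ℂ) • (ρ - τ)).PosSemidef} ∩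
    {t : ℝ | ((1 / 2 : ℂ) • 1 - (ρ + (t : ℂ) • (ρ - τ))).PosSemidef} with hE
  have hEclosed : IsClosed E := by
    refine (isClosed_Ici.inter (isClosed_setOf_posSemidef_add_smul hρ.posSemidef.1 hH)).inter ?_
    simp only [hsub]
    exact isClosed_setOf_posSemidef_add_smul hρ.posSemidef_sub.1
      (hρ.posSemidef_sub.1.sub hτ.posSemidef_sub.1)
  have hEbdd : BddAbove E :=
    (bddAbove_setOf_posSemidef_add_smul (A := ρ) hH
      (by rw [trace_sub, hρ.trace_eq, hτ.trace_eq, sub_self]) (sub_ne_zero.2 hne)).mono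
      fun t ht => ht.1.2
  have hE0 : (0 : ℝ) ∈ E :=
    ⟨⟨Set.self_mem_Ici, by simpa using hρ.posSemidef⟩, by simpa using hρ.posSemidef_sub⟩
  set m := sSup E
  obtain ⟨⟨hm0, hm1⟩, hm2⟩ : m ∈ E := hEclosed.csSup_mem ⟨0, hE0⟩ hEbdd
  have hm0 : 0 ≤ m := hm0
  set ρ' := ρ + (m : ℂ) • (ρ - τ) with hρ'
  have hm1 : ρ'.PosSemidef := hm1
  have hm2 : ((1 / 2 : ℂ) • 1 - ρ').PosSemidef := hm2
  refine ⟨m, hm0, ?_⟩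
  rw [← hρ']
  refine ⟨⟨hm1, hm2, ?_⟩, ?_⟩
  · rw [hρ', ptrace2_add, ptrace2_smul, ptrace2_sub, hρ.ptrace2_eq, hτ.ptrace2_eq, sub_self,
      smul_zero, add_zero]
  have hk0 : LinearMap.ker ρ.mulVecLin ≤ LinearMap.ker ρ'.mulVecLin := by
    intro v hv
    simp only [LinearMap.mem_ker, mulVecLin_apply] at hv ⊢
    rw [hρ', add_mulVec, smul_mulVec, sub_mulVec, hv, h0 v hv]; simp
  have hk1 : LinearMap.ker ((1 / 2 : ℂ) • 1 - ρ).mulVecLin ≤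
      LinearMap.ker ((1 / 2 : ℂ) • 1 - ρ').mulVecLin := by
    intro v hv
    simp only [LinearMap.mem_ker, mulVecLin_apply] at hv ⊢
    rw [hρ', hsub, add_mulVec, smul_mulVec, sub_mulVec (_ - _) (_ - _), hv, h1 v hv]; simp
  have hf0 := Submodule.finrank_mono hk0
  have hf1 := Submodule.finrank_mono hk1
  by_contra hlt
  simp only [extremeDim] at hlt
  have hker0 := Submodule.eq_of_le_of_finrank_le hk0 (by omega)
  have hker1 := Submodule.eq_of_le_of_finrank_le hk1 (by omega)
  obtain ⟨ε₀, hε₀, hp0⟩ := hm1.exists_sub_smul hτ.posSemidef fun v hv => by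
    have : v ∈ LinearMap.ker ρ.mulVecLin := by
      rw [hker0]; exact hv
    exact h0 v this
  obtain ⟨ε₁, hε₁, hp1⟩ := hm2.exists_sub_smul hτ.posSemidef_sub fun v hv => by
    have : v ∈ LinearMap.ker ((1 / 2 : ℂ) • 1 - ρ).mulVecLin := by
      rw [hker1]; exact hv
    exact h1 v this
  set ε := min ε₀ ε₁
  have hε : 0 < ε := lt_min hε₀ hε₁
  replace hp0 := hp0.sub_smul_of_le hτ.posSemidef (min_le_left ε₀ ε₁)
  replace hp1 := hp1.sub_smul_of_le hτ.posSemidef_sub (min_le_right ε₀ ε₁)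
  have hmem : m + ε * (1 + m) ∈ E := by
    refine ⟨⟨Set.mem_Ici.2 (by positivity), ?_⟩, ?_⟩
    · have : ρ + ((m + ε * (1 + m) : ℝ) : ℂ) • (ρ - τ) =
          (ρ' - (ε : ℂ) • τ) + (ε : ℂ) • ρ' := by
        rw [hρ']; push_cast; module
      rw [Set.mem_ofPred_eq, this]
      exact hp0.add (hm1.smul (Complex.zero_le_real.2 hε.le))
    · have : (1 / 2 : ℂ) • 1 - (ρ + ((m + ε * (1 + m) : ℝ) : ℂ) • (ρ - τ)) =
          (((1 / 2 : ℂ) • 1 - ρ') - (ε : ℂ) • ((1 / 2 : ℂ) • 1 - τ)) +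
            (ε : ℂ) • ((1 / 2 : ℂ) • 1 - ρ') := by
        rw [hρ']; push_cast; module
      rw [Set.mem_ofPred_eq, this]
      exact hp1.add (hm2.smul (Complex.zero_le_real.2 hε.le))
  have hle := le_csSup hEbdd hmem
  have : 0 < ε * (1 + m) := by positivity
  linarith

lemma IsHalfBounded.separableState {ρ : Matrix (Fin 2 × Fin 2) (Fin 2 × Fin 2) ℂ}
    (h : IsHalfBounded ρ) : SeparableState ρ := by
  induction hN : 8 - extremeDim ρ using Nat.strong_induction_on generalizing ρ with
  | _ N ih =>
    rcases h.separableState_or_exists_orthogonal with hsep | ⟨ν, ξ, hνξ, hν, hξ⟩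
    · exact hsep
    obtain ⟨τ, hτ, hτsep, hτν, hτξ⟩ := exists_separableState_isHalfBounded hνξ
    by_cases hne : ρ = τ
    · rwa [hne]
    obtain ⟨m, hm, hρ', hlt⟩ := h.exists_extremeDim_lt hτ hne
      (fun v hv => by
        obtain ⟨a, rfl⟩ := hν v hv
        rw [mulVec_smul, hτν, smul_zero])
      (fun v hv => by
        obtain ⟨a, rfl⟩ := hξ v hv
        rw [mulVec_smul, hτξ, smul_zero])
    have hle := extremeDim_le (ρ + (m : ℂ) • (ρ - τ))
    have hsep := ih _ (by omega) hρ' rfl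
    have hpos : 0 < 1 + m := by linarith
    have := hsep.convex_comb hτsep (a := (1 + m)⁻¹) (b := m * (1 + m)⁻¹) (by positivity)
      (by positivity) (by field_simp)
    convert this using 1
    have hinv : ((1 + m)⁻¹ : ℂ) * (1 + m) = 1 :=
      inv_mul_cancel₀ (by exact_mod_cast hpos.ne')
    have hexp : (((1 + m)⁻¹ : ℝ) : ℂ) • (ρ + (m : ℂ) • (ρ - τ)) +
        ((m * (1 + m)⁻¹ : ℝ) : ℂ) • τ = (((1 + m)⁻¹ : ℂ) * (1 + m)) • ρ := by
      push_cast; module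
    rw [hexp, hinv, one_smul]

end Separable

lemma Matrix.IsHermitian.posSemidef_smul_one_sub_iff {n : Type*} [Fintype n] [DecidableEq n]
    {A : Matrix n n ℂ} (hA : A.IsHermitian) (c : ℝ) :
    ((c : ℂ) • (1 : Matrix n n ℂ) - A).PosSemidef ↔ ∀ z ∈ spectrum ℂ A, z ≤ c := by
  have hH : ((c : ℂ) • (1 : Matrix n n ℂ) - A).IsHermitian := by
    rw [IsHermitian, conjTranspose_sub, conjTranspose_smul, hA, conjTranspose_one]; simp
  rw [posSemidef_iff_isHermitian_and_spectrum_nonneg, and_iff_right hH,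
    ← Algebra.algebraMap_eq_smul_one, ← spectrum.singleton_sub_eq]
  simp [Set.singleton_sub, Set.subset_def]

theorem separable_iff_eigenvalues_le_half
    (ρ : Matrix (Fin 2 × Fin 2) (Fin 2 × Fin 2) ℂ) (hρ : IsDensity ρ)
    (hmarg : ptrace2 ρ = (1 / 2 : ℂ) • (1 : Matrix (Fin 2) (Fin 2) ℂ)) :
    SeparableState ρ ↔ ∀ z ∈ spectrum ℂ ρ, z ≤ (1 / 2 : ℂ) := by
  have hc : ((1 / 2 : ℝ) : ℂ) = 1 / 2 := by norm_num
  have hspec := hρ.1.1.posSemidef_smul_one_sub_iff (1 / 2)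
  rw [hc] at hspec
  rw [← hspec]
  refine ⟨fun h => ?_, fun h => IsHalfBounded.separableState ⟨hρ.1, h, hmarg⟩⟩
  have := h.posSemidef_ptrace2_kronecker_one_sub
  rwa [hmarg, smul_kronecker, one_kronecker_one] at this
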